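/- Let a(n) denote the number of permutations of length n (with a(0) = 1 for the empty permutation) lying in the juxtaposition class Av(231|12), i.e. permutations σ of length n for which the positions can be split at some cut point k (0 ≤ k ≤ n) so that σ has no occurrence of the pattern 231 using only positions ≤ k and no occurrence of the pattern 12 using only positions > k. Then the formal power series F(z) = Σ_{n≥0} a(n) z^n over ℚ satisfies the identity (1 + z − 2z(2 − z)·F(z))² = 1 − 6z + 5z² in ℚ[[z]]. (Equivalently, F(z) = (1 + z − √(1−6z+5z²))/(2z(2−z)).) -/

import Mathlib

/-- `σ` contains an occurrence of the pattern `π` using only positions in `S`. -/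
def ContainsIn {n m : ℕ} (σ : Equiv.Perm (Fin n)) (π : Equiv.Perm (Fin m))
    (S : Set (Fin n)) : Prop :=
  ∃ f : Fin m → Fin n, StrictMono f ∧ (∀ s, f s ∈ S) ∧
    ∀ s t : Fin m, σ (f s) < σ (f t) ↔ π s < π t

/-- `σ` contains an occurrence of the pattern `π`. -/
def Contains {n m : ℕ} (σ : Equiv.Perm (Fin n)) (π : Equiv.Perm (Fin m)) : Prop :=
  ContainsIn σ π Set.univ

/-- `σ` avoids the pattern `π`. -/
def Avoids {n m : ℕ} (σ : Equiv.Perm (Fin n)) (π : Equiv.Perm (Fin m)) : Prop :=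
  ¬ Contains σ π

/-- `σ` lies in the juxtaposition class `Av(P|Q)`: positions split at some cut `k`
(`0 ≤ k ≤ n`), no occurrence of `P` within the first `k` positions and no occurrence
of `Q` within the remaining positions. -/
def JuxtAv {n p q : ℕ} (P : Equiv.Perm (Fin p)) (Q : Equiv.Perm (Fin q))
    (σ : Equiv.Perm (Fin n)) : Prop :=
  ∃ k ≤ n, ¬ ContainsIn σ P {i : Fin n | (i : ℕ) < k} ∧
    ¬ ContainsIn σ Q {i : Fin n | k ≤ (i : ℕ)}

noncomputable def p231 : Equiv.Perm (Fin 3) :=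
  Equiv.ofBijective (![1,2,0] : Fin 3 → Fin 3) (by decide)

noncomputable def p12 : Equiv.Perm (Fin 2) :=
  Equiv.ofBijective (![0,1] : Fin 2 → Fin 2) (by decide)

noncomputable def F : PowerSeries ℚ :=
  PowerSeries.mk fun n => (Nat.card {σ : Equiv.Perm (Fin n) // JuxtAv p231 p12 σ} : ℚ)

/-- Recursive form of 231-avoidance for lists. -/
def Av : List ℕ → Prop
  | [] => True
  | b :: l => l.Pairwise (fun c a => b < c → ¬ a < b) ∧ Av l

theorem Av_left {L R : List ℕ} (h : Av (L ++ R)) : Av L := by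
  induction L with
  | nil => trivial
  | cons x L ih =>
    simp only [List.cons_append, Av, List.pairwise_append] at h ⊢
    exact ⟨h.1.1, ih h.2⟩

theorem Av_right {L R : List ℕ} (h : Av (L ++ R)) : Av R := by
  induction L with
  | nil => exact h
  | cons x L ih =>
    simp only [List.cons_append, Av] at h
    exact ih h.2

theorem Av_append {A B : List ℕ} (hA : Av A) (hB : Av B) (h : ∀ x ∈ A, ∀ y ∈ B, x < y) :
    Av (A ++ B) := by
  induction A with
  | nil => exact hB
  | cons x A ih =>
    simp only [List.cons_append, Av] at hA ⊢
    refine ⟨?_, ih hA.2 (fun u hu y hy => h u (by simp [hu]) y hy)⟩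
    rw [List.pairwise_append]
    refine ⟨hA.1, ?_, ?_⟩
    · refine List.pairwise_of_forall_mem_list ?_
      intro c hc a ha _
      have := h x (by simp) a ha
      omega
    · intro c _ a ha _
      have := h x (by simp) a ha
      omega

theorem split_list (b : ℕ) (l : List ℕ) (hb : b ∉ l)
    (h : l.Pairwise (fun c a => b < c → ¬ a < b)) :
    ∃ A B, l = A ++ B ∧ (∀ x ∈ A, x < b) ∧ (∀ x ∈ B, b < x) := by
  induction l with
  | nil => exact ⟨[], [], by simp⟩
  | cons x l ih =>
    simp only [List.mem_cons, not_or] at hb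
    rw [List.pairwise_cons] at h
    obtain ⟨A, B, rfl, hA, hB⟩ := ih hb.2 h.2
    rcases lt_or_ge x b with hx | hx
    · exact ⟨x :: A, B, by simp, by simpa using ⟨hx, hA⟩, hB⟩
    · have hx : b < x := by omega
      refine ⟨[], x :: (A ++ B), by simp, by simp, ?_⟩
      intro y hy
      rcases List.mem_cons.1 hy with rfl | hy
      · exact hx
      · have h1 := h.1 y hy hx
        have h2 : y ≠ b := fun e => hb.2 (e ▸ hy)
        omega

/-- Left cells: repetition-free 231-avoiding lists with entries in `[a, c)`. -/
def InG (a c : ℕ) (l : List ℕ) : Prop := Av l ∧ l.Nodup ∧ ∀ x ∈ l, a ≤ x ∧ x < c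

/-- Minimal left cells. -/
def InF (a c : ℕ) (l : List ℕ) : Prop :=
  InG a c l ∧ ∀ y ∈ l.getLast?, ∃ x, a ≤ x ∧ x < c ∧ x ∉ l ∧ y < x

theorem InG_cons (a c b : ℕ) (l : List ℕ) : InG a c (b :: l) ↔
    a ≤ b ∧ b < c ∧ ∃ A B, InG a b A ∧ InG (b+1) c B ∧ l = A ++ B := by
  constructor
  · rintro ⟨h1, h2, h3⟩
    rw [List.nodup_cons] at h2
    simp only [Av] at h1
    obtain ⟨A, B, rfl, hA, hB⟩ := split_list b l h2.1 h1.1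
    have hb := h3 b (by simp)
    rw [List.nodup_append] at h2
    refine ⟨hb.1, hb.2, A, B, ⟨Av_left h1.2, h2.2.1, ?_⟩, ⟨Av_right h1.2, h2.2.2.1, ?_⟩, rfl⟩
    · intro x hx
      exact ⟨(h3 x (by simp [hx])).1, hA x hx⟩
    · intro x hx
      exact ⟨hB x hx, (h3 x (by simp [hx])).2⟩
  · rintro ⟨hab, hbc, A, B, ⟨hA1, hA2, hA3⟩, ⟨hB1, hB2, hB3⟩, rfl⟩
    refine ⟨⟨?_, ?_⟩, ?_, ?_⟩
    · rw [List.pairwise_append]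
      refine ⟨?_, ?_, ?_⟩
      · refine List.pairwise_of_forall_mem_list ?_
        intro x hx y hy
        have := hA3 x hx
        omega
      · refine List.pairwise_of_forall_mem_list ?_
        intro x hx y hy
        have := hB3 y hy
        omega
      · intro x hx y hy
        have := hB3 y hy
        omega
    · refine Av_append hA1 hB1 ?_
      intro x hx y hy
      have := hA3 x hx
      have := hB3 y hy
      omega
    · rw [List.nodup_cons, List.nodup_append]
      refine ⟨?_, hA2, hB2, ?_⟩
      · intro h
        rcases List.mem_append.1 h with h | h
        · have := hA3 _ h
          omega
        · have := hB3 _ h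
          omega
      · intro x hx y hy
        have := hA3 x hx
        have := hB3 y hy
        omega
    · intro x hx
      simp only [List.mem_cons, List.mem_append] at hx
      rcases hx with rfl | hx | hx
      · exact ⟨hab, hbc⟩
      · have := hA3 x hx
        omega
      · have := hB3 x hx
        omega

theorem InG_nil (a c : ℕ) : InG a c [] := ⟨trivial, by simp, by simp⟩
theorem InF_nil (a c : ℕ) : InF a c [] := ⟨InG_nil a c, by simp⟩

theorem InG_self {a : ℕ} {l : List ℕ} (h : InG a a l) : l = [] := by
  cases l with
  | nil => rfl
  | cons x l =>
    have := h.2.2 x (by simp)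
    omega

theorem InF_cons (a d b : ℕ) (l : List ℕ) : InF a (d+1) (b :: l) ↔
    (a ≤ b ∧ b < d ∧ ∃ A B, InG a b A ∧ InF (b+1) (d+1) B ∧ l = A ++ B) ∨
    (a ≤ b ∧ b = d ∧ l ≠ [] ∧ InF a d l) := by
  constructor
  · rintro ⟨h1, h2⟩
    have h1' := h1
    rw [InG_cons] at h1
    obtain ⟨hab, hbc, A, B, hA, hB, rfl⟩ := h1
    rcases Nat.lt_or_ge b d with hbd | hbd
    · left
      refine ⟨hab, hbd, A, B, hA, ⟨hB, ?_⟩, rfl⟩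
      intro y hy
      have hy' : y ∈ B := List.mem_of_getLast? hy
      obtain ⟨x, hx1, hx2, hx3, hx4⟩ := h2 y (by
        rw [Option.mem_def] at hy ⊢
        simp [List.getLast?_cons, List.getLast?_append, hy])
      have := hB.2.2 y hy'
      refine ⟨x, by omega, hx2, ?_, hx4⟩
      intro h
      exact hx3 (by simp [h])
    · right
      have hbd : b = d := by omega
      subst hbd
      have := InG_self hB
      subst this
      rw [List.append_nil] at *
      refine ⟨hab, rfl, ?_, hA, ?_⟩
      · rintro rfl
        obtain ⟨x, hx1, hx2, hx3, hx4⟩ := h2 b (by simp)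
        omega
      · intro y hy
        obtain ⟨x, hx1, hx2, hx3, hx4⟩ := h2 y (by
          rw [Option.mem_def] at hy ⊢
          simp [List.getLast?_cons, hy])
        simp only [List.mem_cons, not_or] at hx3
        exact ⟨x, hx1, by omega, hx3.2, hx4⟩
  · rintro (⟨hab, hbd, A, B, hA, hB, rfl⟩ | ⟨hab, rfl, hl, hA⟩)
    · refine ⟨(InG_cons _ _ _ _).2 ⟨hab, by omega, A, B, hA, hB.1, rfl⟩, ?_⟩
      intro y hy
      rcases hB' : B.getLast? with _ | z
      · rw [List.getLast?_eq_none_iff] at hB'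
        subst hB'
        rw [List.append_nil] at *
        have hy' := List.mem_of_getLast? hy
        have hyb : ∀ y ∈ b :: A, y ≤ b := by
          intro y hy'
          rcases List.mem_cons.1 hy' with rfl | hy'
          · exact le_rfl
          · exact (hA.2.2 y hy').2.le
        refine ⟨d, by omega, by omega, ?_, ?_⟩
        · intro h
          have := hyb _ h
          omega
        · have := hyb _ hy'
          omega
      · obtain ⟨x, hx1, hx2, hx3, hx4⟩ := hB.2 z hB'
        have : y = z := by
          simp [List.getLast?_cons, List.getLast?_append, hB'] at hy
          exact hy.symm
        subst this
        refine ⟨x, by omega, hx2, ?_, hx4⟩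
        intro h
        simp only [List.mem_cons, List.mem_append] at h
        rcases h with h | h | h
        · omega
        · have := hA.2.2 x h
          omega
        · exact hx3 h
    · refine ⟨(InG_cons _ _ _ _).2 ⟨hab, by omega, l, [], hA.1, InG_nil _ _, by simp⟩, ?_⟩
      intro y hy
      rcases hl' : l.getLast? with _ | z
      · rw [List.getLast?_eq_none_iff] at hl'
        exact absurd hl' hl
      · obtain ⟨x, hx1, hx2, hx3, hx4⟩ := hA.2 z hl'
        have : y = z := by
          simp [List.getLast?_cons, hl'] at hy
          exact hy.symm
        subst this
        refine ⟨x, hx1, by omega, ?_, hx4⟩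
        simp only [List.mem_cons, not_or]
        exact ⟨by omega, hx3⟩

/-- Joining the pieces. -/
def glue (b : ℕ) (A B : List ℕ) : List ℕ := b :: (A ++ B)

def gs : ℕ → ℕ → Finset (List ℕ)
  | 0, _ => {[]}
  | n+1, a => insert [] ((Finset.univ : Finset (Fin (n+1))).biUnion fun i =>
      Finset.image₂ (glue (a+i)) (gs i a) (gs (n-i) (a+i+1)))
termination_by n => n
decreasing_by all_goals omega

def fs : ℕ → ℕ → Finset (List ℕ)
  | 0, _ => {[]}
  | n+1, a => insert [] (((Finset.univ : Finset (Fin n)).biUnion fun i =>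
      Finset.image₂ (glue (a+i)) (gs i a) (fs (n-i) (a+i+1))) ∪
      ((fs n a).erase []).image (fun A => (a+n) :: A))
termination_by n => n
decreasing_by all_goals omega

theorem mem_gs (n : ℕ) : ∀ a l, l ∈ gs n a ↔ InG a (a+n) l := by
  induction n using Nat.strong_induction_on with
  | _ n ih =>
  intro a l
  cases n with
  | zero =>
    rw [gs, Finset.mem_singleton]
    exact ⟨fun h => h ▸ InG_nil _ _, fun h => InG_self h⟩
  | succ n =>
    rw [gs]
    cases l with
    | nil => simp [InG_nil]
    | cons b l =>
      simp only [Finset.mem_insert, reduceCtorEq, false_or, Finset.mem_biUnion, Finset.mem_univ,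
        true_and, Finset.mem_image₂, glue, List.cons.injEq]
      rw [InG_cons]
      constructor
      · rintro ⟨i, A, hA, B, hB, rfl, rfl⟩
        have hi := i.2
        rw [ih _ (by omega)] at hA hB
        refine ⟨by omega, by omega, A, B, hA, ?_, rfl⟩
        convert hB using 1
        omega
      · rintro ⟨h1, h2, A, B, hA, hB, rfl⟩
        refine ⟨⟨b - a, by omega⟩, A, ?_, B, ?_, by simp only []; omega, rfl⟩
        · rw [ih _ (by simp only []; omega)]
          convert hA using 1
          simp only []; omega
        · rw [ih _ (by simp only []; omega)]
          convert hB using 1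
          all_goals (simp only []; omega)

theorem mem_fs (n : ℕ) : ∀ a l, l ∈ fs n a ↔ InF a (a+n) l := by
  induction n using Nat.strong_induction_on with
  | _ n ih =>
  intro a l
  cases n with
  | zero =>
    rw [fs, Finset.mem_singleton]
    exact ⟨fun h => h ▸ InF_nil _ _, fun h => InG_self h.1⟩
  | succ n =>
    rw [fs]
    cases l with
    | nil => simp [InF_nil]
    | cons b l =>
      simp only [Finset.mem_insert, reduceCtorEq, false_or, Finset.mem_biUnion, Finset.mem_univ,
        true_and, Finset.mem_image₂, glue, List.cons.injEq, Finset.mem_union, Finset.mem_image,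
        Finset.mem_erase]
      rw [← add_assoc, InF_cons]
      refine or_congr ?_ ?_
      · constructor
        · rintro ⟨i, A, hA, B, hB, rfl, rfl⟩
          have hi := i.2
          rw [mem_gs] at hA
          rw [ih _ (by omega)] at hB
          refine ⟨by omega, by omega, A, B, hA, ?_, rfl⟩
          convert hB using 1
          omega
        · rintro ⟨h1, h2, A, B, hA, hB, rfl⟩
          refine ⟨⟨b - a, by omega⟩, A, ?_, B, ?_, by simp only []; omega, rfl⟩
          · rw [mem_gs]
            convert hA using 1
            simp only []; omega
          · rw [ih _ (by simp only []; omega)]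
            convert hB using 1
            all_goals (simp only []; omega)
      · constructor
        · rintro ⟨A, ⟨h1, h2⟩, rfl, rfl⟩
          rw [ih _ (by omega)] at h2
          exact ⟨by omega, rfl, h1, h2⟩
        · rintro ⟨h1, rfl, h3, h4⟩
          exact ⟨l, ⟨h3, by rw [ih _ (by omega)]; exact h4⟩, rfl, rfl⟩

theorem append_inj_of {b : ℕ} {A A' B B' : List ℕ} (h : A ++ B = A' ++ B')
    (hA : ∀ x ∈ A, x < b) (hA' : ∀ x ∈ A', x < b) (hB : ∀ x ∈ B, b < x) (hB' : ∀ x ∈ B', b < x) :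
    A = A' ∧ B = B' := by
  have key : ∀ A B : List ℕ, (∀ x ∈ A, x < b) → (∀ x ∈ B, b < x) →
      (A ++ B).filter (· < b) = A := by
    intro A B hA hB
    rw [List.filter_append, List.filter_eq_self.2 (by simpa using hA),
      List.filter_eq_nil_iff.2 (by intro x hx; have := hB x hx; simp; omega), List.append_nil]
  have : A = A' := by rw [← key A B hA hB, ← key A' B' hA' hB', h]
  subst this
  exact ⟨rfl, List.append_cancel_left h⟩

theorem card_glue (b : ℕ) (s t : Finset (List ℕ)) (hs : ∀ A ∈ s, ∀ x ∈ A, x < b)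
    (ht : ∀ A ∈ t, ∀ x ∈ A, b < x) :
    (Finset.image₂ (glue b) s t).card = s.card * t.card := by
  rw [Finset.card_image₂_iff]
  rintro ⟨A, B⟩ h1 ⟨A', B'⟩ h2 h
  simp only [Set.mem_prod, Finset.mem_coe] at h1 h2
  simp only [glue, List.cons.injEq, true_and] at h
  have := append_inj_of h (hs _ h1.1) (hs _ h2.1) (ht _ h1.2) (ht _ h2.2)
  simp [this.1, this.2]

theorem gs_bd {n a : ℕ} {A : List ℕ} (h : A ∈ gs n a) : ∀ x ∈ A, a ≤ x ∧ x < a + n :=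
  ((mem_gs n a A).1 h).2.2
theorem fs_bd {n a : ℕ} {A : List ℕ} (h : A ∈ fs n a) : ∀ x ∈ A, a ≤ x ∧ x < a + n :=
  ((mem_fs n a A).1 h).1.2.2

theorem glue_disj {a : ℕ} {i j : ℕ} (h : i ≠ j) (s t s' t' : Finset (List ℕ)) :
    Disjoint (Finset.image₂ (glue (a+i)) s t) (Finset.image₂ (glue (a+j)) s' t') := by
  rw [Finset.disjoint_left]
  intro l hl hl'
  simp only [Finset.mem_image₂, glue] at hl hl'
  obtain ⟨A, _, B, _, rfl⟩ := hl
  obtain ⟨A', _, B', _, h'⟩ := hl'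
  simp only [List.cons.injEq] at h'
  omega

theorem card_gs_succ (n a : ℕ) : (gs (n+1) a).card =
    1 + ∑ i : Fin (n+1), (gs i a).card * (gs (n-i) (a+i+1)).card := by
  rw [gs, Finset.card_insert_of_notMem (by simp [glue]), Finset.card_biUnion, add_comm]
  · congr 1
    refine Finset.sum_congr rfl fun i _ => card_glue _ _ _ ?_ ?_
    · intro A hA x hx
      exact (gs_bd hA x hx).2
    · intro A hA x hx
      exact (gs_bd hA x hx).1
  · intro i _ j _ hij
    exact glue_disj (fun h => hij (Fin.ext h)) _ _ _ _

theorem card_fs_succ (n a : ℕ) : (fs (n+1) a).card + 1 =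
    1 + ∑ i : Fin n, (gs i a).card * (fs (n-i) (a+i+1)).card + (fs n a).card := by
  rw [fs, Finset.card_insert_of_notMem (by simp [glue]), Finset.card_union_of_disjoint,
    Finset.card_biUnion, Finset.card_image_of_injective]
  · have h0 : [] ∈ fs n a := (mem_fs _ _ _).2 (InF_nil _ _)
    have := Finset.card_erase_add_one h0
    have : ∑ i : Fin n, (Finset.image₂ (glue (a+i)) (gs i a) (fs (n-i) (a+i+1))).card
       = ∑ i : Fin n, (gs i a).card * (fs (n-i) (a+i+1)).card := by
      refine Finset.sum_congr rfl fun i _ => card_glue _ _ _ ?_ ?_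
      · intro A hA x hx
        exact (gs_bd hA x hx).2
      · intro A hA x hx
        exact (fs_bd hA x hx).1
    omega
  · intro A B h
    simpa using h
  · intro i _ j _ hij
    exact glue_disj (fun h => hij (Fin.ext h)) _ _ _ _
  · rw [Finset.disjoint_left]
    intro l hl hl'
    simp only [Finset.mem_biUnion, Finset.mem_image₂, glue, Finset.mem_image] at hl hl'
    obtain ⟨i, _, A, _, B, _, rfl⟩ := hl
    obtain ⟨A', _, h'⟩ := hl'
    simp only [List.cons.injEq] at h'
    have := i.2
    omega

theorem card_gs_shift (n : ℕ) : ∀ a, (gs n a).card = (gs n 0).card := by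
  induction n using Nat.strong_induction_on with
  | _ n ih =>
  intro a
  cases n with
  | zero => simp [gs]
  | succ n =>
    rw [card_gs_succ, card_gs_succ]
    congr 1
    refine Finset.sum_congr rfl fun i _ => ?_
    rw [ih i (by omega) a, ih (n-i) (by omega) (a+i+1), ih (n-i) (by omega) (0+i+1)]

theorem card_fs_shift (n : ℕ) : ∀ a, (fs n a).card = (fs n 0).card := by
  induction n using Nat.strong_induction_on with
  | _ n ih =>
  intro a
  cases n with
  | zero => simp [fs]
  | succ n =>
    apply Nat.add_right_cancel (m := 1)
    rw [card_fs_succ, card_fs_succ, ih n (by omega) a]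
    congr 2
    refine Finset.sum_congr rfl fun i _ => ?_
    rw [card_gs_shift i a, ih (n-i) (by omega) (a+i+1), ih (n-i) (by omega) (0+i+1)]

theorem g_rec (n : ℕ) : (gs (n+1) 0).card =
    1 + ∑ p ∈ Finset.HasAntidiagonal.antidiagonal n, (gs p.1 0).card * (gs p.2 0).card := by
  rw [card_gs_succ, Finset.Nat.sum_antidiagonal_eq_sum_range_succ_mk, ← Finset.sum_range
    (fun i => (gs i 0).card * (gs (n-i) (0+i+1)).card)]
  congr 1
  refine Finset.sum_congr rfl fun i _ => ?_
  rw [card_gs_shift (n-i)]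

theorem f_rec (n : ℕ) : (fs (n+1) 0).card + (gs n 0).card =
    (fs n 0).card + ∑ p ∈ Finset.HasAntidiagonal.antidiagonal n, (gs p.1 0).card * (fs p.2 0).card := by
  have h := card_fs_succ n 0
  rw [← Finset.sum_range (fun i => (gs i 0).card * (fs (n-i) (0+i+1)).card)] at h
  rw [Finset.Nat.sum_antidiagonal_eq_sum_range_succ_mk, Finset.sum_range_succ]
  have h2 : ∑ i ∈ Finset.range n, (gs i 0).card * (fs (n-i) (0+i+1)).card =
      ∑ i ∈ Finset.range n, (gs i 0).card * (fs (n-i) 0).card := by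
    refine Finset.sum_congr rfl fun i _ => ?_
    rw [card_fs_shift (n-i)]
  have h3 : (fs (n - n) 0).card = 1 := by simp [fs]
  simp only [h3]
  omega

/-- Words of the class. -/
def W (n : ℕ) : Set (List ℕ) := {l | l.Nodup ∧ l.length = n ∧ (∀ x ∈ l, x < n) ∧
  ∃ L R, l = L ++ R ∧ Av L ∧ R.Pairwise (fun x y => y < x)}

noncomputable def comp (n : ℕ) (L : List ℕ) : List ℕ :=
  (Finset.range n \ L.toFinset).sort (fun x y => y ≤ x)

theorem mem_comp {n : ℕ} {L : List ℕ} {x : ℕ} : x ∈ comp n L ↔ x < n ∧ x ∉ L := by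
  simp [comp]

theorem comp_pw (n : ℕ) (L : List ℕ) : (comp n L).Pairwise (fun x y => y < x) := by
  have h1 : (comp n L).Pairwise (fun x y => y ≤ x) := Finset.pairwise_sort _ _
  have h2 : (comp n L).Nodup := Finset.sort_nodup _ _
  refine (h1.and h2).imp ?_
  intro a b h
  have := h.1
  have := h.2
  omega

theorem comp_nodup (n : ℕ) (L : List ℕ) : (comp n L).Nodup := Finset.sort_nodup _ _

theorem W_eq (n : ℕ) : W n = Set.image (fun L => L ++ comp n L) (fs n 0 : Set (List ℕ)) := by
  ext l
  constructor
  · rintro ⟨h1, h2, h3, L, R, rfl, hL, hR⟩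
    induction L using List.reverseRecOn generalizing R with
    | nil =>
      refine ⟨[], by simp [mem_fs, InF_nil], ?_⟩
      simp only [List.nil_append] at *
      refine List.Perm.eq_of_pairwise (le := fun x y => y < x) ?_ (comp_pw _ _) hR ?_
      · intro a b _ _ h h'
        omega
      · rw [List.perm_ext_iff_of_nodup (comp_nodup _ _) h1]
        intro x
        rw [mem_comp]
        have hsub : R.toFinset = Finset.range n := by
          apply Finset.eq_of_subset_of_card_le
          · intro x hx
            simpa using h3 x (by simpa using hx)
          · rw [List.toFinset_card_of_nodup h1, h2]; simp
        have := Finset.ext_iff.1 hsub x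
        simp at this
        simp [this]
    | append_singleton L y ih =>
      by_cases hy : ∃ x ∈ R, y < x
      · refine ⟨L ++ [y], ?_, ?_⟩
        · rw [Finset.mem_coe, mem_fs]
          rw [List.nodup_append] at h1
          refine ⟨⟨hL, h1.1, fun x hx => ⟨by omega, ?_⟩⟩, ?_⟩
          · have := h3 x (List.mem_append_left _ hx)
            omega
          · intro z hz
            simp at hz
            subst hz
            obtain ⟨x, hx, hyx⟩ := hy
            refine ⟨x, by omega, ?_, ?_, hyx⟩
            · have := h3 x (List.mem_append_right _ hx)
              omega
            · intro h
              exact h1.2.2 x h x hx rfl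
        · simp only
          congr 1
          refine List.Perm.eq_of_pairwise (le := fun x y => y < x) ?_ (comp_pw _ _) hR ?_
          · intro a b _ _ h h'
            omega
          · have hsub : (L ++ [y] ++ R).toFinset = Finset.range n := by
              apply Finset.eq_of_subset_of_card_le
              · intro x hx
                rw [Finset.mem_range]
                exact h3 x (List.mem_toFinset.1 hx)
              · rw [List.toFinset_card_of_nodup h1, h2]; simp
            rw [List.nodup_append] at h1
            rw [List.perm_ext_iff_of_nodup (comp_nodup _ _) h1.2.1]
            intro x
            rw [mem_comp]
            have := Finset.ext_iff.1 hsub x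
            rw [List.mem_toFinset, Finset.mem_range, List.mem_append] at this
            rw [← this]
            constructor
            · tauto
            · intro h
              exact ⟨Or.inr h, fun h' => h1.2.2 x h' x h rfl⟩
      · push Not at hy
        have e : L ++ [y] ++ R = L ++ (y :: R) := by simp
        rw [e] at h1 h2 h3 ⊢
        refine ih (y :: R) h1 h2 h3 (Av_left hL) ?_
        rw [List.pairwise_cons]
        refine ⟨fun x hx => ?_, hR⟩
        have := hy x hx
        rw [List.nodup_append, List.nodup_cons] at h1
        have : x ≠ y := fun e => h1.2.1.1 (e ▸ hx)
        omega
  · rintro ⟨L, hL, rfl⟩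
    rw [Finset.mem_coe, mem_fs] at hL
    obtain ⟨⟨h1, h2, h3⟩, -⟩ := hL
    have hnd : (L ++ comp n L).Nodup := by
      rw [List.nodup_append]
      refine ⟨h2, comp_nodup _ _, ?_⟩
      rintro x hx _ hy rfl
      exact (mem_comp.1 hy).2 hx
    have hm : ∀ x, x ∈ L ++ comp n L ↔ x < n := by
      intro x
      rw [List.mem_append, mem_comp]
      constructor
      · rintro (h | h)
        · have := h3 x h
          omega
        · exact h.1
      · intro h
        tauto
    refine ⟨hnd, ?_, fun x hx => (hm x).1 hx, L, comp n L, rfl, h1, comp_pw _ _⟩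
    rw [← List.toFinset_card_of_nodup hnd]
    have : (L ++ comp n L).toFinset = Finset.range n := by
      ext x
      rw [List.mem_toFinset, hm, Finset.mem_range]
    rw [this, Finset.card_range]

theorem Phi_inj (n : ℕ) : Set.InjOn (fun L => L ++ comp n L) (fs n 0 : Set (List ℕ)) := by
  have key : ∀ L X, L ++ X ∈ fs n 0 → X ++ comp n (L ++ X) = comp n L → X = [] := by
    intro L X h1 h2
    by_contra hX
    rw [mem_fs] at h1
    obtain ⟨Y, y, rfl⟩ := List.eq_nil_or_concat X |>.resolve_left hX
    obtain ⟨x, _, hx2, hx3, hx4⟩ := h1.2 y (by simp [List.getLast?_append])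
    have hp := comp_pw n L
    rw [← h2, List.pairwise_append] at hp
    have := hp.2.2 y (by simp) x (mem_comp.2 ⟨by omega, hx3⟩)
    omega
  intro L1 h1 L2 h2 h
  simp only at h
  rcases List.append_eq_append_iff.1 h with ⟨X, rfl, hX⟩ | ⟨X, rfl, hX⟩
  · simp [key L1 X h2 hX.symm]
  · simp [key L2 X h1 hX.symm]

theorem Av_iff (l : List ℕ) : Av l ↔ ∀ i j k, (hij : i < j) → (hjk : j < k) → (hk : k < l.length) →
    ¬ (l[k] < l[i] ∧ l[i] < l[j]) := by
  induction l with
  | nil => simp [Av]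
  | cons b l ih =>
    simp only [Av]
    rw [ih, List.pairwise_iff_getElem]
    constructor
    · rintro ⟨h1, h2⟩ i j k hij hjk hk h
      obtain ⟨j, rfl⟩ : ∃ j', j = j' + 1 := ⟨j - 1, by omega⟩
      obtain ⟨k, rfl⟩ : ∃ j', k = j' + 1 := ⟨k - 1, by omega⟩
      simp only [List.length_cons] at hk
      cases i with
      | zero =>
        simp only [List.getElem_cons_succ, List.getElem_cons_zero] at h
        exact h1 j k (by omega) (by omega) (by omega) h.2 h.1
      | succ i =>
        simp only [List.getElem_cons_succ] at h
        exact h2 i j k (by omega) (by omega) (by omega) h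
    · intro h
      refine ⟨?_, ?_⟩
      · intro j k hj hk hjk h1 h2
        exact h 0 (j+1) (k+1) (by omega) (by omega) (by simpa using hk) (by simpa using ⟨h2, h1⟩)
      · intro i j k hij hjk hk h1
        exact h (i+1) (j+1) (k+1) (by omega) (by omega) (by simpa using hk) (by simpa using h1)

/-- The list of values. -/
def word {n : ℕ} (σ : Equiv.Perm (Fin n)) : List ℕ := List.ofFn fun i => (σ i : ℕ)

theorem word_inj (n : ℕ) : Function.Injective (word (n := n)) := by
  intro σ τ h
  have := List.ofFn_injective h
  ext i
  exact congrFun this i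

theorem contains231 {n : ℕ} (σ : Equiv.Perm (Fin n)) (S : Set (Fin n)) :
    ContainsIn σ p231 S ↔ ∃ i j k : Fin n, i < j ∧ j < k ∧ i ∈ S ∧ j ∈ S ∧ k ∈ S ∧
      σ k < σ i ∧ σ i < σ j := by
  constructor
  · rintro ⟨f, h1, h2, h3⟩
    refine ⟨f 0, f 1, f 2, h1 (by decide), h1 (by decide), h2 _, h2 _, h2 _, ?_, ?_⟩
    · rw [h3]; simp [p231]
    · rw [h3]; simp [p231]
  · rintro ⟨i, j, k, hij, hjk, hi, hj, hk, h1, h2⟩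
    refine ⟨![i, j, k], ?_, ?_, ?_⟩
    · rw [Fin.strictMono_iff_lt_succ]
      intro s
      fin_cases s
      · exact hij
      · exact hjk
    · intro s
      fin_cases s
      · exact hi
      · exact hj
      · exact hk
    · have h3 := h1.trans h2
      intro s t
      fin_cases s <;> fin_cases t <;> simp [p231, h1, h2, h3, h1.le, h2.le, h3.le]

theorem contains12 {n : ℕ} (σ : Equiv.Perm (Fin n)) (S : Set (Fin n)) :
    ContainsIn σ p12 S ↔ ∃ i j : Fin n, i < j ∧ i ∈ S ∧ j ∈ S ∧ σ i < σ j := by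
  constructor
  · rintro ⟨f, h1, h2, h3⟩
    refine ⟨f 0, f 1, h1 (by decide), h2 _, h2 _, ?_⟩
    rw [h3]; simp [p12]
  · rintro ⟨i, j, hij, hi, hj, h1⟩
    refine ⟨![i, j], ?_, ?_, ?_⟩
    · rw [Fin.strictMono_iff_lt_succ]
      intro s
      fin_cases s
      exact hij
    · intro s
      fin_cases s
      · exact hi
      · exact hj
    · intro s t
      fin_cases s <;> fin_cases t <;> simp [p12, h1, h1.le]

theorem take_iff {n : ℕ} (σ : Equiv.Perm (Fin n)) (k : ℕ) (hk : k ≤ n) :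
    ¬ ContainsIn σ p231 {i : Fin n | (i : ℕ) < k} ↔ Av ((word σ).take k) := by
  rw [contains231, Av_iff]
  have hlen : ((word σ).take k).length = k := by simp [word, hk]
  constructor
  · intro h x y z hxy hyz hz hh
    rw [hlen] at hz
    refine h ⟨⟨x, by omega⟩, ⟨y, by omega⟩, ⟨z, by omega⟩, hxy, hyz, ?_, ?_, ?_, ?_⟩
    · simp; omega
    · simp; omega
    · simpa using hz
    · simpa [word] using hh
  · rintro h ⟨x, y, z, hxy, hyz, hx, hy, hz, hh⟩
    refine h x y z hxy hyz (by rw [hlen]; exact hz) ?_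
    simpa [word] using hh

theorem drop_iff {n : ℕ} (σ : Equiv.Perm (Fin n)) (k : ℕ) (hk : k ≤ n) :
    ¬ ContainsIn σ p12 {i : Fin n | k ≤ (i : ℕ)} ↔
      ((word σ).drop k).Pairwise (fun x y => y < x) := by
  rw [contains12, List.pairwise_iff_getElem]
  have hlen : ((word σ).drop k).length = n - k := by simp [word]
  constructor
  · intro h x y hx hy hxy
    rw [hlen] at hx hy
    by_contra hh
    simp only [word, List.getElem_drop, List.getElem_ofFn, not_lt] at hh
    refine h ⟨⟨k + x, by omega⟩, ⟨k + y, by omega⟩, ?_, ?_, ?_, ?_⟩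
    · simpa using hxy
    · simp
    · simp
    · refine lt_of_le_of_ne hh ?_
      intro e
      have := σ.injective e
      simp at this
      omega
  · rintro h ⟨x, y, hxy, hx, hy, hh⟩
    have hx : k ≤ (x : ℕ) := hx
    have hy : k ≤ (y : ℕ) := hy
    have h' := h (x - k) (y - k) (by rw [hlen]; omega) (by rw [hlen]; omega) (by omega)
    simp only [word, List.getElem_drop, List.getElem_ofFn, Nat.add_sub_cancel' hx,
      Nat.add_sub_cancel' hy, Fin.eta] at h'
    have : (σ x : ℕ) < σ y := hh
    omega

theorem word_mem_iff {n : ℕ} (σ : Equiv.Perm (Fin n)) : JuxtAv p231 p12 σ ↔ word σ ∈ W n := by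
  constructor
  · rintro ⟨k, hk, h1, h2⟩
    refine ⟨?_, by simp [word], ?_, (word σ).take k, (word σ).drop k, by simp,
      (take_iff σ k hk).1 h1, (drop_iff σ k hk).1 h2⟩
    · rw [word, List.nodup_ofFn]
      exact Fin.val_injective.comp σ.injective
    · intro x hx
      rw [word, List.mem_ofFn] at hx
      obtain ⟨i, rfl⟩ := hx
      exact (σ i).2
  · rintro ⟨_, hl, _, L, R, h, hL, hR⟩
    have hk : L.length ≤ n := by
      rw [← hl, h]; simp
    refine ⟨L.length, hk, ?_, ?_⟩
    · rw [take_iff σ _ hk, h]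
      simpa using hL
    · rw [drop_iff σ _ hk, h]
      simpa using hR

theorem word_surj {n : ℕ} {l : List ℕ} (hl : l ∈ W n) : ∃ σ : Equiv.Perm (Fin n), word σ = l := by
  obtain ⟨h1, rfl, h3, -⟩ := hl
  let f : Fin l.length → Fin l.length := fun i => ⟨l[i], h3 _ (by simp)⟩
  have hf : Function.Injective f := by
    intro i j h
    have h' : l[i] = l[j] := by simpa [f] using h
    exact Fin.ext ((h1.getElem_inj_iff).1 h')
  refine ⟨Equiv.ofBijective f (Finite.injective_iff_bijective.1 hf), ?_⟩
  apply List.ext_getElem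
  · simp [word]
  · intro i h h'
    simp [word, f]

theorem count_eq (n : ℕ) :
    Nat.card {σ : Equiv.Perm (Fin n) // JuxtAv p231 p12 σ} = (fs n 0).card := by
  have e : W n = Set.image word {σ : Equiv.Perm (Fin n) | JuxtAv p231 p12 σ} := by
    ext l
    constructor
    · intro h
      obtain ⟨σ, rfl⟩ := word_surj h
      exact ⟨σ, (word_mem_iff σ).2 h, rfl⟩
    · rintro ⟨σ, h, rfl⟩
      exact (word_mem_iff σ).1 h
  have h1 : (W n).ncard = Set.ncard {σ : Equiv.Perm (Fin n) | JuxtAv p231 p12 σ} := by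
    rw [e, Set.ncard_image_of_injective _ (word_inj n)]
  have h2 : (W n).ncard = (fs n 0).card := by
    rw [W_eq, (Phi_inj n).ncard_image, Set.ncard_coe_finset]
  rw [← h2, h1]
  rfl

open PowerSeries in
theorem stmt_aux :
    (1 + PowerSeries.X - 2 * PowerSeries.X * (2 - PowerSeries.X) * F) ^ 2
      = 1 - 6 * PowerSeries.X + 5 * PowerSeries.X ^ 2 := by
  let G : PowerSeries ℚ := PowerSeries.mk fun n => ((gs n 0).card : ℚ)
  let E : PowerSeries ℚ := PowerSeries.mk fun _ => 1
  have hF : F = PowerSeries.mk fun n => ((fs n 0).card : ℚ) := by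
    simp only [F, count_eq]
  have hE : (1 - X) * E = 1 := by
    have := PowerSeries.mk_one_mul_one_sub_eq_one ℚ
    rw [mul_comm]; exact this
  have hG : G = E + X * (G * G) := by
    ext n
    cases n with
    | zero => simp [G, E, gs]
    | succ n =>
      rw [map_add, PowerSeries.coeff_succ_X_mul, PowerSeries.coeff_mul]
      simp only [G, E, PowerSeries.coeff_mk, g_rec]
      push_cast
      rfl
  have hFG : F + X * G = 1 + X * (F + G * F) := by
    rw [hF]
    ext n
    cases n with
    | zero => simp [fs]
    | succ n =>
      rw [map_add, map_add, PowerSeries.coeff_succ_X_mul, PowerSeries.coeff_succ_X_mul, map_add,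
        PowerSeries.coeff_mul]
      have := f_rec n
      simp only [G, PowerSeries.coeff_mk, PowerSeries.coeff_one]
      rw [if_neg (by omega), zero_add]
      exact_mod_cast this
  generalize F = f at *
  have hX : (X : PowerSeries ℚ) ≠ 0 := PowerSeries.X_ne_zero
  have h1 : X * G * (f - 1) = f - 1 - X * f := by linear_combination -hFG
  have h2 : (1 - X) * G = 1 + (1 - X) * X * G * G := by linear_combination (1 - X) * hG + hE
  have h3 : X * (X * (2 - X) * f ^ 2 - (1 + X) * f + 1) = 0 := by
    linear_combination (-X * (f - 1) ^ 2) * h2 + (1 - X) * (X * f - X * G * (f - 1)) * h1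
  have h4 := (mul_eq_zero.1 h3).resolve_left hX
  linear_combination 4 * X * (2 - X) * h4

theorem stmt :
    (1 + PowerSeries.X - 2 * PowerSeries.X * (2 - PowerSeries.X) * F) ^ 2
      = 1 - 6 * PowerSeries.X + 5 * PowerSeries.X ^ 2 := by
  exact stmt_aux
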